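/- Let w be a generalized trapezoidal word with heart v, let p be the longest palindromic prefix of v and q the longest palindromic suffix of v, and suppose v = p·u·q for some nonempty word u. Then one of the following conditions holds: (i) there exist mutually distinct letters a, b, x and positive integers n, m such that p = (ax)ⁿa, u = x, and q = (bx)ᵐb; (ii) Alph(p) ⊆ Alph(q) or Alph(q) ⊆ Alph(p); (iii) Alph(p) ∩ Alph(q) = ∅. Moreover, if condition (i) holds, then w is rich. -/

import Mathlib

open List

variable {A : Type*} [DecidableEq A]

/-- The alphabet of a word: the finite set of distinct letters occurring in it. -/
def Alph (w : List A) : Finset A := w.toFinset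

/-- The finset of all factors (contiguous subwords) of `w`. -/
def factors (w : List A) : Finset (List A) :=
  ((Finset.range (w.length + 1)) ×ˢ (Finset.range (w.length + 1))).image
    (fun p => (w.drop p.1).take p.2)

/-- Factor complexity: the number of distinct factors of `w` of length `n`. -/
def C (w : List A) (n : ℕ) : ℕ := ((factors w).filter (fun u => u.length = n)).card

/-- Right-valence of `u` in `w`: the number of distinct letters `x` such that `u ++ [x]`
is a factor of `w`. -/
def rightValence (w u : List A) : ℕ := ((Alph w).filter (fun x => u ++ [x] <:+: w)).card

/-- `u` is a right special factor of `w`. -/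
def RightSpecial (w u : List A) : Prop := u <:+: w ∧ 2 ≤ rightValence w u

/-- `R w`: the smallest positive integer `r` such that `w` has no right special factor
of length `r`. -/
noncomputable def R (w : List A) : ℕ :=
  sInf {r : ℕ | 0 < r ∧ ∀ u : List A, u.length = r → ¬ RightSpecial w u}

/-- The number of occurrences of `u` as a factor of `w`. -/
def occCount (w u : List A) : ℕ :=
  ((Finset.range (w.length + 1)).filter
    (fun i => i + u.length ≤ w.length ∧ (w.drop i).take u.length = u)).card

/-- `K w`: the length of the shortest suffix of `w` occurring exactly once in `w`. -/
noncomputable def K (w : List A) : ℕ :=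
  sInf {k : ℕ | ∃ u : List A, u <:+ w ∧ u.length = k ∧ occCount w u = 1}

/-- Left-valence of `u` in `w`. -/
def leftValence (w u : List A) : ℕ := ((Alph w).filter (fun x => x :: u <:+: w)).card

/-- `u` is a left special factor of `w`. -/
def LeftSpecial (w u : List A) : Prop := u <:+: w ∧ 2 ≤ leftValence w u

/-- `L w`: the smallest positive integer `ℓ` such that `w` has no left special factor
of length `ℓ`. -/
noncomputable def L (w : List A) : ℕ :=
  sInf {r : ℕ | 0 < r ∧ ∀ u : List A, u.length = r → ¬ LeftSpecial w u}

/-- `H w`: the length of the shortest prefix of `w` occurring exactly once in `w`. -/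
noncomputable def H (w : List A) : ℕ :=
  sInf {k : ℕ | ∃ u : List A, u <+: w ∧ u.length = k ∧ occCount w u = 1}

/-- A generalized trapezoidal word. -/
def IsGT (w : List A) : Prop :=
  w ≠ [] ∧ ((Alph w).card = 1 ∨
    ∃ m M : ℕ, 0 < m ∧ m ≤ M ∧
      (∀ i, 1 ≤ i → i ≤ m → C w i = (Alph w).card + i - 1) ∧
      (∀ i, m ≤ i → i ≤ M - 1 → C w (i + 1) = C w i) ∧
      (∀ i, M ≤ i → i ≤ w.length → C w (i + 1) = C w i - 1))

/-- The heart of a word: remove the longest prefix and longest suffix consisting of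
letters that occur exactly once in the word (if some letter repeats); otherwise the
word itself. -/
def heart (w : List A) : List A :=
  if ∀ x ∈ w, w.count x = 1 then w
  else
    ((w.dropWhile (fun x => w.count x == 1)).reverse.dropWhile
      (fun x => w.count x == 1)).reverse

/-- A word is rich if it has exactly `|w| + 1` distinct palindromic factors. -/
def Rich (w : List A) : Prop :=
  ((factors w).filter (fun u => u.reverse = u)).card = w.length + 1

/-- `p` is a period of `w`. -/
def IsPeriod (w : List A) (p : ℕ) : Prop :=
  0 < p ∧ ∀ i : ℕ, i + p < w.length → w[i]? = w[i + p]?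

/-- The minimal period of `w`. -/
noncomputable def minPeriod (w : List A) : ℕ := sInf {p : ℕ | IsPeriod w p}

set_option linter.unusedSectionVars false

theorem mem_factors (w t : List A) : t ∈ factors w ↔ t <:+: w := by
  unfold factors
  simp only [Finset.mem_image, Finset.mem_product, Finset.mem_range, Prod.exists]
  constructor
  · rintro ⟨i, j, -, rfl⟩
    exact (List.take_prefix _ _).isInfix.trans (List.drop_suffix _ _).isInfix
  · rintro ⟨s, e, rfl⟩
    refine ⟨s.length, t.length, ⟨?_, ?_⟩, ?_⟩
    · simp only [List.length_append]; omega
    · simp only [List.length_append]; omega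
    · simp

theorem factors_reverse (w t : List A) : t ∈ factors w.reverse ↔ t.reverse ∈ factors w := by
  rw [mem_factors, mem_factors, ← List.reverse_infix, List.reverse_reverse]

theorem C_reverse (w : List A) (n : ℕ) : C w.reverse n = C w n := by
  unfold C
  apply Finset.card_bij (fun t _ => t.reverse)
  · intro t ht
    simp only [Finset.mem_filter, factors_reverse] at ht ⊢
    simpa using ht
  · intro t _ t' _ h
    simpa using h
  · intro t ht
    refine ⟨t.reverse, ?_, by simp⟩
    simp only [Finset.mem_filter, factors_reverse] at ht ⊢
    simpa using ht

theorem C_zero (w : List A) (n : ℕ) (h : w.length < n) : C w n = 0 := by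
  unfold C
  rw [Finset.card_eq_zero, Finset.filter_eq_empty_iff]
  intro t ht
  rw [mem_factors] at ht
  have := ht.length_le
  omega

theorem C_concat (w : List A) (y : A) (hy : y ∉ w) (n : ℕ) (h1 : 1 ≤ n) (h2 : n ≤ w.length + 1) :
    C (w ++ [y]) n = C w n + 1 := by
  unfold C
  have : (factors (w ++ [y])).filter (fun u => u.length = n)
      = insert ((w ++ [y]).drop (w.length + 1 - n)) ((factors w).filter (fun u => u.length = n)) := by
    ext t
    simp only [Finset.mem_filter, mem_factors, Finset.mem_insert, List.infix_concat_iff]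
    constructor
    · rintro ⟨h | h, h'⟩
      · left
        have := List.suffix_iff_eq_drop.1 h
        rw [this]; simp [h']
      · right; exact ⟨h, h'⟩
    · rintro (rfl | ⟨h, h'⟩)
      · exact ⟨Or.inl (List.drop_suffix _ _), by simp; omega⟩
      · exact ⟨Or.inr h, h'⟩
  rw [this, Finset.card_insert_of_notMem]
  simp only [Finset.mem_filter, mem_factors]
  rintro ⟨h, -⟩
  apply hy
  apply h.subset
  rw [List.drop_append_of_le_length (by omega)]
  simp

/-- The complexity grows by at most one at each step. -/
def Slow (w : List A) : Prop := ∀ n, 1 ≤ n → C w (n + 1) ≤ C w n + 1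

theorem Slow.reverse {w : List A} (h : Slow w) : Slow w.reverse := by
  intro n hn
  rw [C_reverse, C_reverse]; exact h n hn

theorem Slow.of_concat {w : List A} {y : A} (hy : y ∉ w) (h : Slow (w ++ [y])) : Slow w := by
  intro n hn
  by_cases h2 : n ≤ w.length
  · have := h n hn
    rw [C_concat w y hy n hn (by omega), C_concat w y hy (n+1) (by omega) (by omega)] at this
    omega
  · rw [C_zero w (n+1) (by omega)]; omega

theorem count_append_one {r s : List A} {y : A} (h : (r ++ [y] ++ s).count y = 1) :
    y ∉ r ∧ y ∉ s := by
  simp only [List.count_append, List.count_singleton_self] at h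
  constructor <;> · rw [← List.count_eq_zero]; omega

theorem Slow.of_append (v s : List A) (hs : ∀ y ∈ s, (v ++ s).count y = 1)
    (h : Slow (v ++ s)) : Slow v := by
  induction s using List.reverseRecOn with
  | nil => simpa using h
  | append_singleton s y ih =>
    have hy := count_append_one (r := v ++ s) (s := []) (y := y) (by simpa using hs y (by simp))
    apply ih
    · intro z hz
      have h1 := hs z (by simp [hz])
      have : z ≠ y := by rintro rfl; exact hy.1 (by simp [hz])
      rw [← List.append_assoc, List.count_append, List.count_singleton] at h1
      simpa [this.symm] using h1
    · rw [← List.append_assoc] at h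
      exact h.of_concat hy.1

theorem Slow.of_heart (r v s : List A) (hr : ∀ y ∈ r, (r ++ v ++ s).count y = 1)
    (hs : ∀ y ∈ s, (r ++ v ++ s).count y = 1) (h : Slow (r ++ v ++ s)) : Slow v := by
  have h1 := Slow.of_append (r ++ v) s hs h
  have h2 : Slow (v.reverse ++ r.reverse) := by simpa using h1.reverse
  have h3 := Slow.of_append v.reverse r.reverse (by
    intro y hy
    have hy' : y ∈ r := by simpa using hy
    have h4 := hr y hy'
    have : 0 < r.count y := List.count_pos_iff.2 hy'
    simp only [List.count_append, List.count_reverse] at h4 ⊢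
    omega) h2
  simpa using h3.reverse

theorem IsGT.slow {w : List A} (hw : IsGT w) (h1 : (Alph w).card ≠ 1) : Slow w := by
  obtain ⟨-, h | ⟨m, M, hm, hM, ha, hb, hc⟩⟩ := hw
  · exact absurd h h1
  intro n hn
  by_cases hl : w.length < n
  · rw [C_zero w (n+1) (by omega)]; omega
  by_cases h2 : n + 1 ≤ m
  · rw [ha n hn (by omega), ha (n+1) (by omega) h2]; omega
  by_cases h3 : n ≤ M - 1
  · rw [hb n (by omega) h3]; omega
  · rw [hc n (by omega) (by omega)]; omega

theorem heart_spec (w : List A) : ∃ r s : List A, w = r ++ heart w ++ s ∧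
    (∀ y ∈ r, w.count y = 1) ∧ (∀ y ∈ s, w.count y = 1) := by
  unfold heart
  split_ifs with h
  · exact ⟨[], [], by simp, by simp, by simp⟩
  · set f : A → Bool := fun x => w.count x == 1 with hf
    refine ⟨w.takeWhile f, ((w.dropWhile f).reverse.takeWhile f).reverse, ?_, ?_, ?_⟩
    · rw [List.append_assoc, ← List.reverse_append, List.takeWhile_append_dropWhile,
        List.reverse_reverse, List.takeWhile_append_dropWhile]
    · intro y hy
      have := List.mem_takeWhile_imp hy
      simpa [hf] using this
    · intro y hy
      rw [List.mem_reverse] at hy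
      have := List.mem_takeWhile_imp hy
      simpa [hf] using this

theorem C_one (v : List A) : C v 1 = (Alph v).card := by
  unfold C Alph
  symm
  apply Finset.card_bij (fun y _ => [y])
  · intro y hy
    simp only [List.mem_toFinset] at hy
    obtain ⟨s, t, rfl⟩ := List.append_of_mem hy
    simp only [Finset.mem_filter, mem_factors]
    exact ⟨⟨s, t, by simp⟩, rfl⟩
  · intro y _ z _ h; simpa using h
  · intro t ht
    simp only [Finset.mem_filter, mem_factors, List.length_eq_one_iff] at ht
    obtain ⟨h, y, rfl⟩ := ht
    exact ⟨y, by simpa using h.subset (by simp), rfl⟩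

/-! ### Palindromic richness -/

/-- The set of palindromic factors. -/
def pals (w : List A) : Finset (List A) := (factors w).filter (fun u => u.reverse = u)

theorem mem_pals (w t : List A) : t ∈ pals w ↔ t <:+: w ∧ t.reverse = t := by
  simp [pals, mem_factors]

theorem pals_reverse (w : List A) : pals w.reverse = pals w := by
  ext t
  rw [mem_pals, mem_pals]
  constructor
  · rintro ⟨h, h'⟩; refine ⟨?_, h'⟩; rw [← List.reverse_infix, h']; exact h
  · rintro ⟨h, h'⟩; refine ⟨?_, h'⟩; rw [← h', List.reverse_infix]; exact h

theorem Rich.reverse {w : List A} (h : Rich w) : Rich w.reverse := by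
  have h1 : (pals w).card = w.length + 1 := h
  have : (pals w.reverse).card = w.reverse.length + 1 := by
    rw [pals_reverse, List.length_reverse, h1]
  exact this

theorem infix_of_two_suffix {w t t' : List A} {y : A} (h : t <:+ w ++ [y]) (h' : t' <:+ w ++ [y])
    (hp : t.reverse = t) (hp' : t'.reverse = t') (hl : t.length < t'.length) : t <:+: w := by
  have h1 : t <:+ t' := List.suffix_of_suffix_length_le h h' hl.le
  have h2 : t <+: t' := by
    rw [← hp, ← hp']; exact List.reverse_prefix.2 h1
  rcases List.suffix_concat_iff.1 h' with rfl | ⟨t'', rfl, h3⟩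
  · simp at hl
  · rcases List.prefix_concat_iff.1 h2 with rfl | h4
    · simp at hl
    · exact h4.isInfix.trans h3.isInfix

theorem pals_concat_le (w : List A) (y : A) : (pals (w ++ [y])).card ≤ (pals w).card + 1 := by
  have : pals w ⊆ pals (w ++ [y]) := by
    intro t; rw [mem_pals, mem_pals]
    exact fun h => ⟨h.1.trans (List.prefix_append _ _).isInfix, h.2⟩
  have h2 := Finset.card_sdiff_add_card_eq_card this
  have h3 : (pals (w ++ [y]) \ pals w).card ≤ 1 := by
    rw [Finset.card_le_one]
    have key : ∀ t ∈ pals (w ++ [y]) \ pals w, t <:+ w ++ [y] ∧ t.reverse = t ∧ ¬ t <:+: w := by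
      intro t ht
      rw [Finset.mem_sdiff, mem_pals, mem_pals, List.infix_concat_iff] at ht
      obtain ⟨⟨h | h, h'⟩, h''⟩ := ht
      · exact ⟨h, h', fun h3 => h'' ⟨h3, h'⟩⟩
      · exact absurd ⟨h, h'⟩ h''
    intro t ht t' ht'
    obtain ⟨a1, a2, a3⟩ := key t ht
    obtain ⟨b1, b2, b3⟩ := key t' ht'
    rcases lt_trichotomy t.length t'.length with h | h | h
    · exact absurd (infix_of_two_suffix a1 b1 a2 b2 h) a3
    · exact (List.suffix_of_suffix_length_le a1 b1 h.le).eq_of_length h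
    · exact absurd (infix_of_two_suffix b1 a1 b2 a2 h) b3
  omega

theorem Rich.concat {w : List A} (h : Rich w) (y : A) (t : List A) (ht : t.reverse = t)
    (hs : t <:+ w ++ [y]) (hn : ¬ t <:+: w) : Rich (w ++ [y]) := by
  have h1 : (pals w).card = w.length + 1 := h
  have h2 := pals_concat_le w y
  have h3 : insert t (pals w) ⊆ pals (w ++ [y]) := by
    intro z
    rw [Finset.mem_insert, mem_pals, mem_pals]
    rintro (rfl | h)
    · exact ⟨hs.isInfix, ht⟩
    · exact ⟨h.1.trans (List.prefix_append _ _).isInfix, h.2⟩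
  have h4 := Finset.card_le_card h3
  rw [Finset.card_insert_of_notMem (by rw [mem_pals]; exact fun h => hn h.1)] at h4
  have : (pals (w ++ [y])).card = (w ++ [y]).length + 1 := by
    rw [List.length_append, List.length_singleton]; omega
  exact this

theorem Rich.concat_new {w : List A} (h : Rich w) (y : A) (hy : y ∉ w) : Rich (w ++ [y]) :=
  h.concat y [y] (by simp) (List.suffix_append _ _) (fun h => hy (h.subset (by simp)))

theorem Rich.append_new (v s : List A) (hs : ∀ y ∈ s, (v ++ s).count y = 1) (h : Rich v) :
    Rich (v ++ s) := by
  induction s using List.reverseRecOn with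
  | nil => simpa using h
  | append_singleton s y ih =>
    have hy := count_append_one (r := v ++ s) (s := []) (y := y) (by simpa using hs y (by simp))
    rw [← List.append_assoc]
    apply Rich.concat_new _ y hy.1
    apply ih
    intro z hz
    have h1 := hs z (by simp [hz])
    have : z ≠ y := by rintro rfl; exact hy.1 (by simp [hz])
    rw [← List.append_assoc, List.count_append, List.count_singleton] at h1
    simpa [this.symm] using h1

theorem Rich.of_heart (r v s : List A) (hr : ∀ y ∈ r, (r ++ v ++ s).count y = 1)
    (hs : ∀ y ∈ s, (r ++ v ++ s).count y = 1) (h : Rich v) : Rich (r ++ v ++ s) := by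
  apply Rich.append_new _ _ hs
  have h3 := Rich.append_new v.reverse r.reverse (by
    intro y hy
    have hy' : y ∈ r := by simpa using hy
    have h4 := hr y hy'
    have : 0 < r.count y := List.count_pos_iff.2 hy'
    simp only [List.count_append, List.count_reverse] at h4 ⊢
    omega) h.reverse
  simpa using h3.reverse

/-- The word `(ax)ⁿa`. -/
def W (a x : A) (n : ℕ) : List A := (List.replicate n [a, x]).flatten ++ [a]

theorem W_zero (a x : A) : W a x 0 = [a] := by simp [W]
theorem W_succ (a x : A) (n : ℕ) : W a x (n+1) = a :: x :: W a x n := by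
  simp [W, List.replicate_succ]
theorem W_succ' (a x : A) (n : ℕ) : W a x (n+1) = W a x n ++ [x, a] := by
  induction n with
  | zero => simp [W]
  | succ n ih => rw [W_succ, ih, ← List.cons_append, ← List.cons_append, ← W_succ, ih]
theorem W_reverse (a x : A) (n : ℕ) : (W a x n).reverse = W a x n := by
  induction n with
  | zero => simp [W]
  | succ n ih => rw [W_succ', List.reverse_append, ih, ← W_succ', W_succ]; simp
theorem W_shift (a x : A) (n : ℕ) : a :: W x a n = W a x n ++ [x] := by
  induction n with
  | zero => simp [W]
  | succ n ih => rw [W_succ x a, ih, W_succ]; simp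
theorem W_length (a x : A) (n : ℕ) : (W a x n).length = 2 * n + 1 := by
  induction n with
  | zero => simp [W]
  | succ n ih => rw [W_succ']; simp [ih]; omega

theorem not_infix_count {t w : List A} {y : A} (h : w.count y < t.count y) : ¬ t <:+: w :=
  fun hi => absurd (hi.sublist.count_le y) (by omega)

/-- Extending by `x`, `b` alternately. -/
theorem Rich.blocks (V : List A) (b x : A) (hbx : b ≠ x) (hb : b ∉ V) (hV : Rich (V ++ [x])) (m : ℕ) :
    Rich (V ++ [x] ++ W b x m) := by
  have cnt : ∀ m, (W b x m).count b = m + 1 := by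
    intro m
    induction m with
    | zero => simp [W]
    | succ n ih => rw [W_succ]; simp [ih, hbx.symm]
  have cntV : V.count b = 0 := List.count_eq_zero.2 hb
  induction m with
  | zero =>
    rw [W_zero]
    apply hV.concat_new
    simp [hb, hbx]
  | succ m ih =>
    have h1 : Rich (V ++ [x] ++ W b x m ++ [x]) := by
      apply ih.concat x (W x b (m+1)) (W_reverse _ _ _)
      · refine ⟨V, ?_⟩
        have := W_shift b x m
        rw [W_succ, this]; simp
      · rintro ⟨s, e, h⟩
        rw [W_succ, W_shift] at h
        rcases List.eq_nil_or_concat e with rfl | ⟨e', z, rfl⟩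
        · have h5 : (s ++ x :: W b x m) ++ [x] =
              (V ++ [x] ++ (List.replicate m [b, x]).flatten) ++ [b] := by simpa [W] using h
          have h6 := (List.append_inj' h5 rfl).2
          simp at h6
          exact hbx h6.symm
        · have h5 : (s ++ x :: (W b x m ++ [x]) ++ e') ++ [z] =
              (V ++ [x] ++ (List.replicate m [b, x]).flatten) ++ [b] := by simpa [W] using h
          have h5 := (List.append_inj' h5 rfl).2
          simp at h5
          subst h5
          have h6 := congrArg (List.count z) h
          simp [cnt, cntV, hbx.symm] at h6
          omega
    have h2 := h1.concat b (W b x (m+1)) (W_reverse _ _ _) ⟨V ++ [x], by rw [W_succ']; simp⟩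
      (not_infix_count (y := b) (by simp [cnt, cntV, hbx.symm]))
    rw [W_succ']
    simpa using h2

theorem Rich.nil : Rich ([] : List A) := by
  have : pals ([] : List A) = {[]} := by
    ext t; rw [mem_pals]; simp; rintro rfl; rfl
  have h : (pals ([] : List A)).card = ([] : List A).length + 1 := by rw [this]; simp
  exact h

theorem rich_v (a b x : A) (n m : ℕ) (hab : a ≠ b) (hax : a ≠ x) (hbx : b ≠ x) :
    Rich (W a x n ++ [x] ++ W b x m) := by
  have h0 : Rich [x] := Rich.nil.concat_new x (by simp)
  have h1 : Rich ([x] ++ W a x n) := by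
    simpa using Rich.blocks [] a x hax (by simp) (by simpa using h0) n
  have h2 : Rich (W a x n ++ [x]) := by simpa [W_reverse] using h1.reverse
  apply Rich.blocks _ b x hbx _ h2 m
  simp [W, hab.symm, hbx]

/-! ### Combinatorics of the heart -/

theorem closed_mem (S : A → Prop) (l : List A) (h0 : ∀ y, l.head? = some y → S y)
    (hs : ∀ y z, [y, z] <:+: l → S y → S z) : ∀ y ∈ l, S y := by
  induction l with
  | nil => simp
  | cons y l ih =>
    have hy : S y := h0 y rfl
    intro z hz
    rcases List.mem_cons.1 hz with rfl | hz
    · exact hy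
    · apply ih _ _ z hz
      · intro t ht
        cases l with
        | nil => simp at ht
        | cons t' l =>
          simp at ht; subst ht
          exact hs y t' ⟨[], l, by simp⟩ hy
      · intro t t' h
        exact hs t t' (h.trans (List.suffix_cons _ _).isInfix)

theorem eq_W (a x : A) (hax : a ≠ x) (k : ℕ) : ∀ l : List A, l.length ≤ k →
    (∀ y z, [y, z] <:+: l → (y = a ∧ z = x) ∨ (y = x ∧ z = a)) →
    l.head? = some a → l.getLast? = some a → ∃ n, l = W a x n := by
  induction k with
  | zero => intro l hl; have : l = [] := by simpa using hl
            subst this; simp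
  | succ k ih =>
    intro l hl hE h1 h2
    match l, hl, hE, h1, h2 with
    | [y], _, _, h1, _ => exact ⟨0, by simp at h1; simp [W, h1]⟩
    | [y, z], _, hE, h1, h2 =>
      simp at h1 h2
      subst h1; subst h2
      have := hE z z (List.infix_refl _)
      grind
    | y :: z :: t :: l, hl, hE, h1, h2 =>
      simp at h1; subst h1
      have e1 := hE y z ⟨[], t :: l, by simp⟩
      have e2 := hE z t ⟨[y], l, by simp⟩
      have hz : z = x := by grind
      have ht : t = y := by grind
      obtain ⟨n, hn⟩ := ih (t :: l) (by simp at hl ⊢; omega)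
        (fun y' z' h => hE y' z' (h.trans ⟨[y, z], [], by simp⟩)) (by simp [ht]) (by simpa using h2)
      exact ⟨n + 1, by rw [W_succ, ← hn, hz]⟩

theorem head_getLast_of_pal {l : List A} (h : l.reverse = l) : l.getLast? = l.head? := by
  rw [← List.head?_reverse, h]

theorem out_lemma (v : List A) (hC : C v 2 ≤ (Alph v).card + 1)
    (hout : ∀ y ∈ v, ∃ z, [y, z] <:+: v) (a0 : A) :
    ∃ f : A → A, ∃ c d : A, ∀ y z, [y, z] <:+: v → z = f y ∨ (y = c ∧ z = d) := by
  have : ∀ y, ∃ z, y ∈ v → [y, z] <:+: v := by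
    intro y
    by_cases h : y ∈ v
    · obtain ⟨z, hz⟩ := hout y h; exact ⟨z, fun _ => hz⟩
    · exact ⟨y, fun h' => absurd h' h⟩
  choose f hf using this
  set F := (factors v).filter (fun u => u.length = 2) with hF
  set I := (Alph v).image (fun y => [y, f y]) with hI
  have hIc : I.card = (Alph v).card := by
    apply Finset.card_image_of_injective
    intro y z h; simp at h; exact h.1
  have hsub : I ⊆ F := by
    intro t ht
    simp only [hI, Finset.mem_image, Alph, List.mem_toFinset] at ht
    obtain ⟨y, hy, rfl⟩ := ht
    simp only [hF, Finset.mem_filter, mem_factors]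
    exact ⟨hf y hy, rfl⟩
  have h2 := Finset.card_sdiff_add_card_eq_card hsub
  have h3 : (F \ I).card ≤ 1 := by
    have : F.card ≤ (Alph v).card + 1 := hC
    omega
  rw [Finset.card_le_one] at h3
  have key : ∀ y z, [y, z] <:+: v → z ≠ f y → [y, z] ∈ F \ I := by
    intro y z h hz
    simp only [Finset.mem_sdiff, hF, hI, Finset.mem_filter, mem_factors, Finset.mem_image]
    refine ⟨⟨h, rfl⟩, ?_⟩
    rintro ⟨y', -, h'⟩
    simp at h'
    obtain ⟨rfl, h'⟩ := h'
    exact hz h'.symm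
  by_cases hex : ∃ c d, [c, d] <:+: v ∧ d ≠ f c
  · obtain ⟨c, d, h, h'⟩ := hex
    refine ⟨f, c, d, fun y z hyz => ?_⟩
    by_cases hz : z = f y
    · exact Or.inl hz
    · right
      have := h3 _ (key y z hyz hz) _ (key c d h h')
      simpa using this
  · push Not at hex
    exact ⟨f, a0, a0, fun y z h => Or.inl (hex y z h)⟩

theorem out_of_pal (v q : List A) (hq : q <:+ v) (hpal : q.reverse = q) (h2 : 2 ≤ q.length) :
    ∀ y ∈ v, ∃ z, [y, z] <:+: v := by
  intro y hy
  obtain ⟨s, t, rfl⟩ := List.append_of_mem hy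
  match t, hq with
  | z :: t, _ => exact ⟨z, s, t, by simp⟩
  | [], hq =>
    match q, h2, hpal, hq with
    | c :: z :: q, _, hpal, hq =>
      have h3 := head_getLast_of_pal hpal
      obtain ⟨s', hs'⟩ := hq
      have h4 := congrArg List.getLast? hs'
      rw [List.getLast?_append, h3] at h4
      simp at h4
      subst h4
      exact ⟨z, s', q, by simpa using hs'⟩

theorem two_le_length {l : List A} {a x : A} (ha : a ∈ l) (hx : x ∈ l) (h : a ≠ x) :
    2 ≤ l.length := by
  match l, ha, hx with
  | [y], ha, hx => simp at ha hx; exact absurd (ha.trans hx.symm) h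
  | _ :: _ :: _, _, _ => simp

theorem pal_two (v p : List A) (hpv : p <+: v) (hpal : p.reverse = p) (f : A → A) (c d : A)
    (hE : ∀ y z, [y, z] <:+: v → z = f y ∨ (y = c ∧ z = d)) (a x b : A) (ha : a ∈ p) (hx : x ∈ p)
    (hax : a ≠ x) (hbv : b ∈ v) (hbp : b ∉ p) :
    (∀ y ∈ p, y = a ∨ y = x) ∧ [a, x] <:+: p ∧ [x, a] <:+: p := by
  have hl := two_le_length ha hx hax
  have hEp : ∀ y z, [y, z] <:+: p → z = f y ∨ (y = c ∧ z = d) :=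
    fun y z h => hE y z (h.trans hpv.isInfix)
  have hsym : ∀ y z, [y, z] <:+: p → [z, y] <:+: p := by
    intro y z h
    rw [← List.reverse_infix, hpal]; simpa using h
  have hcross : ∃ y z, [y, z] <:+: v ∧ y ∈ p ∧ z ∉ p := by
    by_contra hcon
    push Not at hcon
    apply hbp
    refine closed_mem (fun y => y ∈ p) v ?_ hcon b hbv
    intro y hy
    obtain ⟨t, rfl⟩ := hpv
    match p, hl with
    | p0 :: _, _ => simp at hy; simp [hy]
  obtain ⟨y, z, hyz, hyp, hzp⟩ := hcross
  obtain ⟨y', hy'⟩ := out_of_pal p p (List.suffix_refl _) hpal hl y hyp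
  have hy'p : y' ∈ p := hy'.subset (by simp)
  have hfun : ∀ s t t', [s, t] <:+: p → [s, t'] <:+: p → t = t' := by
    intro s t t' h h'
    have m1 : t ∈ p := h.subset (by simp)
    have m2 : t' ∈ p := h'.subset (by simp)
    have e1 := hEp _ _ h
    have e2 := hEp _ _ h'
    have e3 := hE _ _ hyz
    have e4 := hEp _ _ hy'
    grind
  obtain ⟨p0, p1, p2, rfl⟩ : ∃ p0 p1 p2, p = p0 :: p1 :: p2 := by
    match p, hl with
    | p0 :: p1 :: p2, _ => exact ⟨p0, p1, p2, rfl⟩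
  have h01 : [p0, p1] <:+: p0 :: p1 :: p2 := ⟨[], p2, by simp⟩
  have h10 := hsym _ _ h01
  have hall : ∀ y ∈ p0 :: p1 :: p2, y = p0 ∨ y = p1 := by
    apply closed_mem
    · intro y hy; simp at hy; exact Or.inl hy.symm
    · rintro s t h (rfl | rfl)
      · right; exact hfun _ _ _ h h01
      · left; exact hfun _ _ _ h h10
  have e1 := hall a ha
  have e2 := hall x hx
  refine ⟨fun y hy => ?_, ?_, ?_⟩
  · have := hall y hy; grind
  · rcases e1 with rfl | rfl <;> rcases e2 with rfl | rfl
    · exact absurd rfl hax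
    · exact h01
    · exact h10
    · exact absurd rfl hax
  · rcases e1 with rfl | rfl <;> rcases e2 with rfl | rfl
    · exact absurd rfl hax
    · exact h10
    · exact h01
    · exact absurd rfl hax

/-- Edges of order one in the heart. -/
def Edges (v : List A) (a b x : A) : Prop :=
  ∀ y z, [y, z] <:+: v → (y = a ∧ z = x) ∨ (y = x ∧ z = a) ∨ (y = b ∧ z = x) ∨ (y = x ∧ z = b)

theorem Edges.at {v : List A} {a b x : A} (h : Edges v a b x) (s t : List A) (y z : A)
    (hv : v = s ++ y :: z :: t) :
    (y = a ∧ z = x) ∨ (y = x ∧ z = a) ∨ (y = b ∧ z = x) ∨ (y = x ∧ z = b) :=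
  h y z ⟨s, t, by simp [hv]⟩

theorem Edges.reverse {v : List A} {a b x : A} (h : Edges v a b x) : Edges v.reverse b a x := by
  intro y z hyz
  have : [z, y] <:+: v := by
    rw [← List.reverse_infix]; simpa using hyz
  have := h z y this
  grind

theorem Edges.sub {v l : List A} {a b x : A} (h : Edges v a b x) (hl : l <:+: v) (hb : b ∉ l) :
    ∀ y z, [y, z] <:+: l → (y = a ∧ z = x) ∨ (y = x ∧ z = a) := by
  intro y z hyz
  have h1 := h y z (hyz.trans hl)
  have m1 : y ∈ l := hyz.subset (by simp)
  have m2 : z ∈ l := hyz.subset (by simp)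
  grind

theorem Edges.symm {v : List A} {a b x : A} (h : Edges v a b x) : Edges v b a x := by
  intro y z hyz
  have := h y z hyz
  grind

theorem no_bxb (v q : List A) (a b x : A) (hab : a ≠ b) (hax : a ≠ x) (hbx : b ≠ x)
    (hE : Edges v a b x) (hq : q <:+ v) (hqpal : q.reverse = q)
    (hqmax : ∀ q' : List A, q' <:+ v → q'.reverse = q' → q'.length ≤ q.length)
    (hbq : b ∈ q) (hxq : x ∈ q) (haq : a ∉ q) (hbxb : ¬ [b, x, b] <:+: v)
    (hbxa : [b, x, a] <:+: v) (hhead : v.head? ≠ some b) : False := by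
  have hEq := hE.symm.sub hq.isInfix haq
  have hgl := head_getLast_of_pal hqpal
  have hqx : q = [x, b, x] := by
    have hh : q.head? = some b ∨ q.head? = some x := by
      match q, two_le_length hbq hxq hbx with
      | y :: z :: q, _ =>
        have := hEq y z ⟨[], q, by simp⟩
        simp; grind
    rcases hh with hh | hh
    · obtain ⟨n, hn⟩ := eq_W b x hbx _ q le_rfl hEq hh (hgl.trans hh)
      exfalso
      match n, hn with
      | 0, hn => rw [W_zero] at hn; subst hn; simp at hxq; exact hbx hxq.symm
      | n + 1, hn =>
        apply hbxb
        refine List.IsInfix.trans ?_ hq.isInfix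
        rw [hn]
        cases n with
        | zero => rw [W_succ, W_zero]
        | succ n => rw [W_succ, W_succ]; exact ⟨[], x :: W b x n, by simp⟩
    · obtain ⟨n, hn⟩ := eq_W x b hbx.symm _ q le_rfl (fun y z h => by
        have := hEq y z h; grind) hh (hgl.trans hh)
      match n, hn with
      | 0, hn => rw [W_zero] at hn; subst hn; simp at hbq; exact absurd hbq hbx
      | 1, hn => rw [hn, W_succ, W_zero]
      | n + 2, hn =>
        exfalso
        apply hbxb
        refine List.IsInfix.trans ?_ hq.isInfix
        rw [hn, W_succ, W_succ]
        exact ⟨[x], W x b n, by simp⟩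
  obtain ⟨s1, s2, hs⟩ := hbxa
  have hs2 : q <:+ s2 := by
    rcases List.suffix_or_suffix_of_suffix hq (⟨s1 ++ [b, x, a], hs⟩ : s2 <:+ v) with h | h
    · exact h
    · obtain ⟨t, ht⟩ := h
      rcases List.eq_nil_or_concat t with rfl | ⟨t', z, rfl⟩
      · simp at ht; rw [ht]
      · exfalso
        obtain ⟨r, hr⟩ := hq
        have h5 : (r ++ t' ++ [z]) ++ s2 = (s1 ++ [b, x] ++ [a]) ++ s2 := by
          rw [← ht] at hr
          simp at hr hs ⊢
          rw [hr, hs]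
        have h6 := List.append_cancel_right h5
        have h7 := (List.append_inj' h6 rfl).2
        simp at h7
        subst h7
        apply haq
        rw [← ht]; simp
  obtain ⟨s3, rfl⟩ := hs2
  have hbt : b ∈ (s1 ++ [b, x, a] ++ s3).reverse := by simp
  obtain ⟨m', z', hmz, hbm⟩ := List.eq_append_cons_of_mem hbt
  obtain ⟨m, rfl⟩ : ∃ m, m' = m.reverse := ⟨m'.reverse, by simp⟩
  obtain ⟨z, rfl⟩ : ∃ z, z' = z.reverse := ⟨z'.reverse, by simp⟩
  have ht : s1 ++ [b, x, a] ++ s3 = z ++ b :: m := by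
    apply List.reverse_injective
    rw [hmz]; simp
  have hbm : b ∉ m := by simpa using hbm
  have hv : v = z ++ b :: m ++ [x, b, x] := by
    rw [← ht, ← hs, hqx]; simp
  clear hs ht hmz hbt
  -- z ends with x
  rcases List.eq_nil_or_concat z with rfl | ⟨z', y, rfl⟩
  · apply hhead; rw [hv]; simp
  have hy := hE.at z' (m ++ [x, b, x]) y b (by rw [hv]; simp)
  have hy : y = x := by grind
  subst hy
  -- m nonempty
  match m, hbm, hv with
  | [], _, hv => exact hbxb ⟨z'.concat y, [y], by rw [hv]; simp⟩
  | m0 :: m, hbm, hv =>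
    have h1 := hE.at (z'.concat y) (m ++ [y, b, y]) b m0 (by rw [hv]; simp)
    have hm0 : m0 = y := by grind
    subst hm0
    have hsub := hE.sub (l := m0 :: m ++ [m0]) ⟨z' ++ [m0] ++ [b], [b, m0], by rw [hv]; simp⟩
      (by simp at hbm ⊢; grind)
    obtain ⟨n, hn⟩ := eq_W m0 a hax.symm _ (m0 :: m ++ [m0]) le_rfl (fun y z h => by
        have := hsub y z h; grind) (by simp) (by rw [List.getLast?_append]; simp)
    have := hqmax (m0 :: b :: W m0 a n ++ [b, m0]) ⟨z', by rw [← hn, hv]; simp⟩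
      (by simp [W_reverse])
    rw [hqx] at this
    simp at this
    omega

theorem near_pal (a x : A) (hax : a ≠ x) (P : List A) (hP : P ≠ [])
    (hE : ∀ y z, [y, z] <:+: P ++ [x] → (y = a ∧ z = x) ∨ (y = x ∧ z = a)) :
    P.reverse = P ∨ (P ++ [x]).reverse = P ++ [x] := by
  obtain ⟨l, y, hl⟩ := (List.eq_nil_or_concat P).resolve_left hP
  have hy : y = a := by
    have := hE y x ⟨l, [], by rw [hl]; simp⟩
    grind
  obtain ⟨c, P', rfl⟩ : ∃ c P', P = c :: P' := by
    match P, hP with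
    | c :: P', _ => exact ⟨c, P', rfl⟩
  have hc : c = a ∨ c = x := by
    cases P' with
    | nil => have := hE c x ⟨[], [], by simp⟩
             grind
    | cons d P' => have := hE c d ⟨[], P' ++ [x], by simp⟩
                   grind
  rcases hc with rfl | rfl
  · left
    obtain ⟨n, hn⟩ := eq_W c x hax _ (c :: P') le_rfl
      (fun y z h => hE y z (h.trans (List.prefix_append _ _).isInfix)) (by simp)
      (by rw [hl, hy]; simp)
    rw [hn, W_reverse]
  · right
    obtain ⟨n, hn⟩ := eq_W c a hax.symm _ (c :: P' ++ [c]) le_rfl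
      (fun y z h => by have := hE y z h; grind) (by simp) (by rw [List.getLast?_append]; simp)
    rw [hn, W_reverse]

theorem main_comb (v p q u : List A) (hS : Slow v)
    (hp : p <+: v) (hppal : p.reverse = p)
    (hpmax : ∀ p' : List A, p' <+: v → p'.reverse = p' → p'.length ≤ p.length)
    (hq : q <:+ v) (hqpal : q.reverse = q)
    (hqmax : ∀ q' : List A, q' <:+ v → q'.reverse = q' → q'.length ≤ q.length)
    (hu : u ≠ []) (hvpq : v = p ++ u ++ q) (a b x : A)
    (hap : a ∈ p) (haq : a ∉ q) (hbq : b ∈ q) (hbp : b ∉ p) (hxp : x ∈ p) (hxq : x ∈ q) :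
    ∃ n m : ℕ, 0 < n ∧ 0 < m ∧ a ≠ b ∧ a ≠ x ∧ b ≠ x ∧ p = W a x n ∧ u = [x] ∧ q = W b x m := by
  have hab : a ≠ b := by rintro rfl; exact haq hbq
  have hax : a ≠ x := by rintro rfl; exact haq hxq
  have hbx : b ≠ x := by rintro rfl; exact hbp hxp
  have hav : a ∈ v := hp.subset hap
  have hbv : b ∈ v := hq.subset hbq
  have hxv : x ∈ v := hq.subset hxq
  have hpl := two_le_length hap hxp hax
  have hql := two_le_length hbq hxq hbx
  have hC2 : C v 2 ≤ (Alph v).card + 1 := by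
    have := hS 1 le_rfl
    rwa [C_one] at this
  have hp' : p <:+ v.reverse := by rw [← hppal]; exact List.reverse_suffix.2 hp
  have hq' : q <+: v.reverse := by rw [← hqpal]; exact List.reverse_prefix.2 hq
  -- right special structure
  obtain ⟨f, c, d, hf⟩ := out_lemma v hC2 (out_of_pal v q hq hqpal hql) a
  obtain ⟨f', c', d', hf'⟩ := out_lemma v.reverse
    (by rw [C_reverse]; simpa [Alph] using hC2) (out_of_pal v.reverse p hp' hppal hpl) a
  obtain ⟨hpa, pax, pxa⟩ := pal_two v p hp hppal f c d hf a x b hap hxp hax hbv hbp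
  obtain ⟨hqb, qbx, qxb⟩ := pal_two v.reverse q hq' hqpal f' c' d' hf' b x a hbq hxq hbx
    (by simpa using hav) haq
  have hE : Edges v a b x ∧ ∀ y ∈ v, y = a ∨ y = b ∨ y = x := by
    have e1 := hf _ _ (pax.trans hp.isInfix)
    have e2 := hf _ _ (pxa.trans hp.isInfix)
    have e3 := hf _ _ (qbx.trans hq.isInfix)
    have e4 := hf _ _ (qxb.trans hq.isInfix)
    have hcx : c = x := by grind
    have hstep : ∀ y z, [y, z] <:+: v → (y = a ∨ y = b ∨ y = x) →
        (y = a ∧ z = x) ∨ (y = x ∧ z = a) ∨ (y = b ∧ z = x) ∨ (y = x ∧ z = b) := by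
      intro y z h hy
      have := hf y z h
      grind
    have hall : ∀ y ∈ v, y = a ∨ y = b ∨ y = x := by
      apply closed_mem
      · intro y hy
        have : y ∈ p := by
          rw [hvpq] at hy
          match p, hpl with
          | p0 :: _, _ => simp at hy; simp [hy]
        have := hpa y this
        grind
      · intro y z h hy
        have := hstep y z h hy
        grind
    exact ⟨fun y z h => hstep y z h (hall y (h.subset (by simp))), hall⟩
  obtain ⟨hE, hall⟩ := hE
  have hcard : (Alph v).card ≤ 3 := by
    have : Alph v ⊆ {a, b, x} := by
      intro y hy
      simp only [Alph, List.mem_toFinset] at hy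
      simpa using hall y hy
    exact (Finset.card_le_card this).trans Finset.card_le_three
  have hC3 : C v 3 ≤ 5 := by
    have : C v 3 ≤ C v 2 + 1 := hS 2 (by norm_num)
    omega
  have hheadp : ∀ y, v.head? = some y → y ∈ p := by
    intro y hy
    rw [hvpq] at hy
    match p, hpl with
    | p0 :: _, _ => simp at hy; simp [hy]
  have hlastq : ∀ y, v.getLast? = some y → y ∈ q := by
    intro y hy
    rw [hvpq, List.getLast?_append] at hy
    apply List.mem_of_getLast?
    obtain ⟨l, z, hl⟩ := (List.eq_nil_or_concat q).resolve_left (by rintro rfl; simp at hbq)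
    rw [hl] at hy ⊢
    simpa using hy
  -- first b
  obtain ⟨P, T, hv, hbP⟩ := List.eq_append_cons_of_mem hbv
  have hpP : p <+: P := by
    rcases List.prefix_or_prefix_of_prefix hp (⟨b :: T, hv.symm⟩ : P <+: v) with h | h
    · exact h
    · obtain ⟨t, ht⟩ := h
      cases t with
      | nil => simp at ht; rw [ht]
      | cons z t =>
        exfalso
        have h1 : P ++ (z :: t ++ u ++ q) = P ++ (b :: T) := by
          rw [← hv, hvpq, ← ht]; simp
        have h2 := List.append_cancel_left h1
        simp at h2
        apply hbp
        rw [← ht, h2.1]; simp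
  have haP : a ∈ P := hpP.subset hap
  obtain ⟨P', y, rfl⟩ : ∃ P' y, P = P' ++ [y] := by
    rcases List.eq_nil_or_concat P with rfl | ⟨P', y, rfl⟩
    · simp at haP
    · exact ⟨P', y, by simp⟩
  have hy := hE.at P' T y b (by rw [hv]; simp)
  have hy : y = x := by grind
  subst hy
  have haP' : a ∈ P' := by simpa [hax] using haP
  have hP'ne : P' ≠ [] := by rintro rfl; simp at haP'
  have hEP := hE.sub (l := P' ++ [y]) ⟨[], b :: T, by rw [hv]; simp⟩ hbP
  by_cases haT : a ∈ T
  · exfalso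
    obtain ⟨T1, T2, hT, haT1⟩ := List.eq_append_cons_of_mem haT
    -- bxa
    have hbxa : [b, y, a] <:+: v := by
      rcases List.eq_nil_or_concat T1 with rfl | ⟨T1', z, rfl⟩
      · have := hE.at (P' ++ [y]) T2 b a (by rw [hv, hT]; simp)
        grind
      · have h1 := hE.at (P' ++ [y] ++ b :: T1') T2 z a (by rw [hv, hT]; simp)
        have hz : z = y := by grind
        subst hz
        rcases List.eq_nil_or_concat T1' with rfl | ⟨T1'', z', rfl⟩
        · exact ⟨P' ++ [z], T2, by rw [hv, hT]; simp⟩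
        · have h2 := hE.at (P' ++ [z] ++ b :: T1'') (a :: T2) z' z (by rw [hv, hT]; simp)
          have : z' ≠ a := by rintro rfl; apply haT1; simp
          have hz' : z' = b := by grind
          subst hz'
          exact ⟨P' ++ [z] ++ z' :: T1'', T2, by rw [hv, hT]; simp⟩
    have haxb : [a, y, b] <:+: v := by
      obtain ⟨P'', z, hP''⟩ := (List.eq_nil_or_concat P').resolve_left hP'ne
      have h1 := hEP z y ⟨P'', [], by rw [hP'']; simp⟩
      have hz : z = a := by grind
      subst hz
      exact ⟨P'', T, by rw [hv, hP'']; simp⟩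
    have hxbx : [y, b, y] <:+: v := by
      cases T with
      | nil => simp at haT
      | cons z T =>
        have := hE.at (P' ++ [y]) T b z hv
        have hz : z = y := by grind
        subst hz
        exact ⟨P', T, by rw [hv]; simp⟩
    have hxax : [y, a, y] <:+: v := by
      obtain ⟨s, e, hs⟩ := hbxa
      cases e with
      | nil =>
        exfalso; apply haq; apply hlastq; rw [← hs]; simp
      | cons z e =>
        have := hE.at (s ++ [b, y]) e a z (by rw [← hs]; simp)
        have hz : z = y := by grind
        subst hz
        exact ⟨s ++ [b], e, by rw [← hs]; simp⟩
    have hnot : ¬ ([a, y, a] <:+: v ∧ [b, y, b] <:+: v) := by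
      rintro ⟨h1, h2⟩
      have hsub : ({[b, y, a], [a, y, b], [y, b, y], [y, a, y], [a, y, a], [b, y, b]} :
          Finset (List A)) ⊆ (factors v).filter (fun u => u.length = 3) := by
        intro t ht
        simp only [Finset.mem_insert, Finset.mem_singleton] at ht
        rw [Finset.mem_filter, mem_factors]
        rcases ht with rfl | rfl | rfl | rfl | rfl | rfl <;> exact ⟨by assumption, rfl⟩
      have h3 := Finset.card_le_card hsub
      have h4 : ({[b, y, a], [a, y, b], [y, b, y], [y, a, y], [a, y, a], [b, y, b]} :
          Finset (List A)).card = 6 := by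
        have := hab.symm
        have := hax.symm
        have := hbx.symm
        repeat rw [Finset.card_insert_of_notMem (by simp [*])]
        simp
      have h5 : ((factors v).filter (fun u => u.length = 3)).card ≤ 5 := hC3
      omega
    by_cases h2 : [b, y, b] <:+: v
    · have h1 : ¬ [a, y, a] <:+: v := fun h => hnot ⟨h, h2⟩
      apply no_bxb v.reverse p b a y hab.symm hbx hax hE.reverse hp' hppal _ hap hxp hbp
      · intro h; apply h1; rw [← List.reverse_infix]; simpa using h
      · rw [← List.reverse_infix]; simpa using hbxa
      · rw [List.head?_reverse]; exact fun h => haq (hlastq a h)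
      · intro p' h h'
        apply hpmax p' _ h'
        rw [← List.reverse_suffix, h']; exact h
    · exact no_bxb v q a b y hab hax hbx hE hq hqpal hqmax hbq hxq haq h2 hbxa
        (fun h => hbp (hheadp b h))
  · have h1 : P'.length ≤ p.length := by
      rcases near_pal a y hax P' hP'ne hEP with h | h
      · exact hpmax _ ⟨[y] ++ b :: T, by rw [hv]; simp⟩ h
      · have := hpmax _ ⟨b :: T, hv.symm⟩ h
        simp at this; omega
    have hEQ := hE.symm.sub (l := y :: b :: T) ⟨P', [], by rw [hv]; simp⟩
      (by simp [hab, hax, haT])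
    have h2 : T.length + 1 ≤ q.length := by
      have key := near_pal b y hbx (b :: T).reverse (by simp) (by
        intro z z' h
        have h' : [z', z] <:+: y :: b :: T := by
          rw [← List.reverse_infix]; simpa using h
        have := hEQ z' z h'
        grind)
      rcases key with h | h
      · rw [List.reverse_reverse] at h
        have := hqmax (b :: T) ⟨P' ++ [y], hv.symm⟩ h.symm
        simpa using this
      · have := hqmax (y :: b :: T) ⟨P', by rw [hv]; simp⟩ (by simpa using h.symm)
        simp at this; omega
    have hlen := congrArg List.length (hvpq.symm.trans hv)
    have hul : 0 < u.length := List.length_pos_iff.2 hu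
    simp only [List.length_append, List.length_cons, List.length_nil] at hlen
    have h3 : p ++ (u ++ q) = P' ++ ([y] ++ b :: T) := by
      rw [← List.append_assoc, ← hvpq, hv]; simp
    obtain ⟨e1, h4⟩ := List.append_inj h3 (by omega)
    obtain ⟨e2, e3⟩ := List.append_inj h4 (by simp; omega)
    have hEp : ∀ s t, [s, t] <:+: p → _ := fun s t h =>
      hEP s t (h.trans (by rw [e1]; exact (List.prefix_append _ _).isInfix))
    have hEq : ∀ s t, [s, t] <:+: q → _ := fun s t h =>
      hEQ s t (h.trans (by rw [e3]; exact (List.suffix_cons _ _).isInfix))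
    have hlp : p.getLast? = some a := by
      obtain ⟨P'', z, hP''⟩ := (List.eq_nil_or_concat P').resolve_left hP'ne
      have h1 := hEP z y ⟨P'', [], by rw [hP'']; simp⟩
      have hz : z = a := by grind
      rw [e1, hP'', hz]; simp
    obtain ⟨n, hn⟩ := eq_W a y hax _ p le_rfl hEp ((head_getLast_of_pal hppal).symm.trans hlp) hlp
    have hhq : q.head? = some b := by rw [e3]; rfl
    obtain ⟨m, hm⟩ := eq_W b y hbx _ q le_rfl hEq hhq ((head_getLast_of_pal hqpal).trans hhq)
    have l1 := W_length a y n
    have l2 := W_length b y m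
    rw [← hn] at l1
    rw [← hm] at l2
    exact ⟨n, m, by omega, by omega, hab, hax, hbx, hn, e2, hm⟩

theorem stmt17 (w : List A) (hw : IsGT w) (v p q u : List A) (hv : v = heart w)
    (hp : p <+: v) (hppal : p.reverse = p)
    (hpmax : ∀ p' : List A, p' <+: v → p'.reverse = p' → p'.length ≤ p.length)
    (hq : q <:+ v) (hqpal : q.reverse = q)
    (hqmax : ∀ q' : List A, q' <:+ v → q'.reverse = q' → q'.length ≤ q.length)
    (hu : u ≠ []) (hvpq : v = p ++ u ++ q) :
    ((∃ a b x : A, ∃ n m : ℕ, 0 < n ∧ 0 < m ∧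
        a ≠ b ∧ a ≠ x ∧ b ≠ x ∧
        p = (List.replicate n [a, x]).flatten ++ [a] ∧ u = [x] ∧
        q = (List.replicate m [b, x]).flatten ++ [b]) ∨
     (Alph p ⊆ Alph q ∨ Alph q ⊆ Alph p) ∨
     Alph p ∩ Alph q = ∅) ∧
    ((∃ a b x : A, ∃ n m : ℕ, 0 < n ∧ 0 < m ∧
        a ≠ b ∧ a ≠ x ∧ b ≠ x ∧
        p = (List.replicate n [a, x]).flatten ++ [a] ∧ u = [x] ∧
        q = (List.replicate m [b, x]).flatten ++ [b]) → Rich w) := by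
  obtain ⟨r, s, hrs, hr, hs⟩ := heart_spec w
  rw [← hv] at hrs
  constructor
  · by_cases h1 : (Alph w).card = 1
    · right; left; left
      obtain ⟨z, hz⟩ := Finset.card_eq_one.1 h1
      have hsub : ∀ y ∈ v, y = z := by
        intro y hy
        have : y ∈ Alph w := by
          rw [hrs]; simp [Alph, hy]
        rw [hz] at this
        simpa using this
      by_cases hq0 : q = []
      · subst hq0
        have hpos : 0 < v.length := by
          rw [hvpq]; have := List.length_pos_iff.2 hu; simp; omega
        obtain ⟨l, y, hl⟩ := (List.eq_nil_or_concat v).resolve_left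
          (by intro h; rw [h] at hpos; simp at hpos)
        have := hqmax [y] ⟨l, by rw [hl]; simp⟩ (by simp)
        simp at this
      · obtain ⟨y, hy⟩ := List.exists_mem_of_ne_nil q hq0
        have hyz := hsub y (hq.subset hy)
        intro t ht
        simp only [Alph, List.mem_toFinset] at ht ⊢
        rw [hsub t (hp.subset ht), ← hyz]
        exact hy
    · have hS : Slow v := by
        apply Slow.of_heart r v s
        · rw [← hrs]; exact hr
        · rw [← hrs]; exact hs
        · rw [← hrs]; exact hw.slow h1
      by_contra hcon
      push Not at hcon
      obtain ⟨c1, ⟨c2, c3⟩, c4⟩ := hcon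
      obtain ⟨a, ha, ha'⟩ := Finset.not_subset.1 c2
      obtain ⟨b, hb, hb'⟩ := Finset.not_subset.1 c3
      obtain ⟨x, hx⟩ := c4
      simp only [Alph, List.mem_toFinset, Finset.mem_inter] at ha ha' hb hb' hx
      obtain ⟨n, m, hn, hm, hab, hax, hbx, e1, e2, e3⟩ := main_comb v p q u hS hp hppal hpmax hq
        hqpal hqmax hu hvpq a b x ha ha' hb hb' hx.1 hx.2
      exact c1 a b x n m hn hm hab hax hbx e1 e2 e3
  · rintro ⟨a, b, x, n, m, hn, hm, hab, hax, hbx, e1, e2, e3⟩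
    rw [hrs]
    apply Rich.of_heart
    · rw [← hrs]; exact hr
    · rw [← hrs]; exact hs
    · rw [hvpq, e1, e2, e3]
      exact rich_v a b x n m hab hax hbx
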